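/- arXiv:math/0004140 — 4 statements merged into one kernel-verified Lean document; each statement's English description precedes it below -/
import Mathlib

section
/- Let X be an h-homogeneous compact Hausdorff space and G = Aut(X) with the compact-open topology. Then G is a minimal topological group: every Hausdorff group topology on the group G that is coarser than (contained in) the compact-open topology coincides with the compact-open topology. -/
open Set TopologicalSpace Filter

/-- A compact Hausdorff space is h-homogeneous if it is nonempty, zero-dimensional
(clopen sets form a basis) and all nonempty clopen subsets are homeomorphic. -/
def IsHHomogeneous (X : Type*) [TopologicalSpace X] : Prop :=
  Nonempty X ∧ IsTopologicalBasis {s : Set X | IsClopen s} ∧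
    ∀ U V : Set X, IsClopen U → IsClopen V → U.Nonempty → V.Nonempty → Nonempty (U ≃ₜ V)

/-- The group of self-homeomorphisms, with `(f * g) x = f (g x)`. -/
instance homeoGroup (X : Type*) [TopologicalSpace X] : Group (X ≃ₜ X) where
  mul f g := g.trans f
  one := Homeomorph.refl X
  inv := Homeomorph.symm
  mul_assoc f g h := Homeomorph.ext fun _ => rfl
  one_mul f := Homeomorph.ext fun _ => rfl
  mul_one f := Homeomorph.ext fun _ => rfl
  inv_mul_cancel f := Homeomorph.ext fun x => f.symm_apply_apply x

/-- The compact-open topology on the group of self-homeomorphisms. -/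
instance homeoTop (X : Type*) [TopologicalSpace X] : TopologicalSpace (X ≃ₜ X) :=
  TopologicalSpace.induced (fun f => (f : C(X, X))) ContinuousMap.compactOpen

open scoped Topology

namespace IsHHomogeneous

universe u

variable {X : Type u} [TopologicalSpace X]

/-- Two locally constant maps with the same range differ by a homeomorphism, which can be taken
to be the identity on the common fibres. -/
theorem exists_homeomorph_comp_eq (hX : IsHHomogeneous X) {ι : Type*} {c d : X → ι}
    (hc : IsLocallyConstant c) (hd : IsLocallyConstant d) (hcd : range c = range d) :
    ∃ k : X ≃ₜ X, (∀ x, d (k x) = c x) ∧ ∀ x, c ⁻¹' {c x} = d ⁻¹' {c x} → k x = x := by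
  have key : ∀ i, ∃ e : (c ⁻¹' {i}) ≃ₜ (d ⁻¹' {i}),
      c ⁻¹' {i} = d ⁻¹' {i} → ∀ x, (e x : X) = x := by
    intro i
    by_cases h : c ⁻¹' {i} = d ⁻¹' {i}
    · exact ⟨Homeomorph.setCongr h, fun _ _ => rfl⟩
    · have hne : ∀ {c d : X → ι}, range c = range d → (d ⁻¹' {i}).Nonempty →
          (c ⁻¹' {i}).Nonempty := by
        rintro c d hcd ⟨x, hx⟩
        obtain ⟨y, hy⟩ : d x ∈ range c := hcd ▸ mem_range_self x
        exact ⟨y, hy.trans hx⟩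
      have hc0 : (c ⁻¹' {i}).Nonempty := by
        by_contra h0
        have h1 : ¬ (d ⁻¹' {i}).Nonempty := fun h2 => h0 (hne hcd h2)
        rw [not_nonempty_iff_eq_empty] at h0 h1
        exact h (h0.trans h1.symm)
      obtain ⟨e⟩ := hX.2.2 _ _ (hc.isClopen_fiber i) (hd.isClopen_fiber i) hc0
        (hne hcd.symm hc0)
      exact ⟨e, fun h' => absurd h' h⟩
  choose e he using key
  let E : X ≃ X := (Equiv.sigmaFiberEquiv c).symm.trans
    ((Equiv.sigmaCongrRight fun i => (e i).toEquiv).trans (Equiv.sigmaFiberEquiv d))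
  have hE : ∀ i (x : X) (hx : c x = i), E x = e i ⟨x, hx⟩ := by
    rintro i x rfl
    rfl
  have hE' : ∀ i (x : X) (hx : d x = i), E.symm x = (e i).symm ⟨x, hx⟩ := by
    rintro i x rfl
    rfl
  have cont : ∀ {c d : X → ι} (E : X → X) (e : ∀ i, (c ⁻¹' {i}) ≃ₜ (d ⁻¹' {i})),
      IsLocallyConstant c → (∀ i (x : X) (hx : c x = i), E x = e i ⟨x, hx⟩) →
      Continuous E := by
    intro c d E e hc hE
    rw [continuous_iff_continuousAt]
    intro x
    have h1 : ContinuousOn E (c ⁻¹' {c x}) := by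
      rw [continuousOn_iff_continuous_domRestrict]
      have h2 : (c ⁻¹' {c x}).domRestrict E = fun y => (e (c x) y : X) := by
        funext y
        exact hE _ _ y.2
      rw [h2]
      exact continuous_subtype_val.comp (e (c x)).continuous
    exact h1.continuousAt ((hc.isOpen_fiber (c x)).mem_nhds rfl)
  refine ⟨⟨E, cont E e hc hE, cont E.symm (fun i => (e i).symm) hd hE'⟩, fun x => ?_,
    fun x hx => ?_⟩
  · change d (E x) = c x
    rw [hE _ x rfl]
    exact (e (c x) ⟨x, rfl⟩).2
  · change E x = x
    rw [hE _ x rfl]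
    exact he _ hx _

theorem ne_singleton_of_isClopen [Nontrivial X] (hX : IsHHomogeneous X) {U : Set X}
    (hU : IsClopen U) (x : X) : U ≠ {x} := by
  rintro rfl
  obtain ⟨e⟩ := hX.2.2 _ _ hU isClopen_univ (singleton_nonempty x) univ_nonempty
  obtain ⟨a, b, hab⟩ := exists_pair_ne X
  refine hab ?_
  have := e.symm.injective (Subsingleton.elim (e.symm ⟨a, mem_univ a⟩) (e.symm ⟨b, mem_univ b⟩))
  exact congrArg Subtype.val this

/-- Every nonempty finite set is the range of a locally constant map. -/
theorem exists_isLocallyConstant_range_eq [T2Space X] [Nontrivial X] (hX : IsHHomogeneous X)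
    {ι : Type*} {S : Set ι} (hS : S.Finite) (hS0 : S.Nonempty) :
    ∃ d : X → ι, IsLocallyConstant d ∧ range d = S := by
  classical
  induction S, hS using Set.Finite.induction_on with
  | empty => exact absurd hS0 not_nonempty_empty
  | @insert a S ha _ ih =>
    rcases S.eq_empty_or_nonempty with rfl | hS1
    · exact ⟨fun _ => a, IsLocallyConstant.const a, by simp⟩
    obtain ⟨d, hd, hdS⟩ := ih hS1
    obtain ⟨x⟩ := hX.1
    obtain ⟨y, hy, hyx⟩ : ∃ y ∈ d ⁻¹' {d x}, y ≠ x := by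
      by_contra! h
      exact hX.ne_singleton_of_isClopen (hd.isClopen_fiber (d x)) x
        (Subset.antisymm h (singleton_subset_iff.2 rfl))
    obtain ⟨U, hU, hxU, hUsub⟩ := hX.2.1.exists_subset_of_mem_open
      (show x ∈ d ⁻¹' {d x} ∩ {y}ᶜ from ⟨rfl, hyx.symm⟩)
      ((hd.isOpen_fiber _).inter isOpen_compl_singleton)
    have hU' : IsClopen U := hU
    refine ⟨fun z => if z ∈ U then a else d z, ?_, ?_⟩
    · have h1 : IsLocallyConstant fun z => (z ∈ U) := by
        rw [IsLocallyConstant.iff_eventually_eq]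
        intro z
        by_cases hz : z ∈ U
        · filter_upwards [hU'.isOpen.mem_nhds hz] with w hw
          simp [hz, hw]
        · filter_upwards [hU'.compl.isOpen.mem_nhds hz] with w hw
          have hw' : w ∉ U := hw
          simp [hz, hw']
      have h2 := (h1.prodMk hd).comp fun p : Prop × ι => if p.1 then a else p.2
      exact h2
    · ext s
      constructor
      · rintro ⟨z, rfl⟩
        by_cases hz : z ∈ U
        · simp [hz]
        · simp only [hz, if_false]
          exact Or.inr (hdS ▸ mem_range_self z)
      · rintro (rfl | hs)
        · exact ⟨x, by simp [hxU]⟩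
        · rw [← hdS] at hs
          obtain ⟨z, rfl⟩ := hs
          by_cases hz : z ∈ U
          · refine ⟨y, ?_⟩
            have hyU : y ∉ U := fun h => (hUsub h).2 rfl
            simp only [hyU, if_false]
            rw [show d y = d x from hy, show d z = d x from (hUsub hz).1]
          · exact ⟨z, by simp [hz]⟩

/-- A locally constant map lifts along `φ` to a locally constant map with any prescribed
finite range compatible with `φ`. -/
theorem exists_lift [T2Space X] [Nontrivial X] (hX : IsHHomogeneous X)
    {ι κ : Type*} {S : Set κ} (hS : S.Finite) {p : X → ι} (hp : IsLocallyConstant p) (φ : κ → ι)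
    (h : φ '' S = range p) :
    ∃ c : X → κ, IsLocallyConstant c ∧ range c = S ∧ ∀ x, φ (c x) = p x := by
  have hS0 : S.Nonempty := by
    rw [← image_nonempty (f := φ), h]
    exact range_nonempty p
  obtain ⟨d, hd, hdS⟩ := hX.exists_isLocallyConstant_range_eq hS hS0
  obtain ⟨k, hk, -⟩ := hX.exists_homeomorph_comp_eq hp (hd.comp φ) (by
    rw [range_comp, hdS, h])
  refine ⟨d ∘ k, hd.comp_continuous k.continuous, ?_, hk⟩
  rw [k.surjective.range_comp, hdS]

/-- Elements with the same incidence relation with respect to `q` lie in the same double coset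
of the stabilizer of `q`. -/
theorem exists_eq_mul_mul (hX : IsHHomogeneous X) {ι : Type*} {q : X → ι}
    (hq : IsLocallyConstant q) (f g : X ≃ₜ X)
    (hfg : range (fun x => (q x, q (f x))) = range fun x => (q x, q (g x))) :
    ∃ a b : X ≃ₜ X, q ∘ a = q ∧ q ∘ b = q ∧ f = a * g * b := by
  obtain ⟨k, hk, -⟩ := hX.exists_homeomorph_comp_eq
    (hq.prodMk (hq.comp_continuous f.continuous))
    (hq.prodMk (hq.comp_continuous g.continuous)) hfg
  refine ⟨f * k⁻¹ * g⁻¹, k, ?_, ?_, by group⟩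
  · funext x
    change q (f (k.symm (g.symm x))) = q x
    have := congrArg Prod.snd (hk (k.symm (g.symm x)))
    simpa using this.symm
  · funext x
    exact congrArg Prod.fst (hk x)

/-- The incidence relation of `g` with respect to `q` is full. -/
def IsFull {ι : Type*} (q : X → ι) (g : X ≃ₜ X) : Prop :=
  ∀ x y, ∃ z, q z = q x ∧ q (g z) = q y

theorem IsFull.range_eq {ι : Type*} {q : X → ι} {g : X ≃ₜ X} (hg : IsFull q g) :
    range (fun x => (q x, q (g x))) = range q ×ˢ range q := by
  ext ⟨i, j⟩
  constructor
  · rintro ⟨x, hx⟩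
    rw [← hx]
    exact ⟨⟨_, rfl⟩, ⟨_, rfl⟩⟩
  · rintro ⟨⟨x, hx⟩, ⟨y, hy⟩⟩
    obtain ⟨z, h1, h2⟩ := hg x y
    exact ⟨z, Prod.ext (h1.trans hx) (h2.trans hy)⟩

/-- A neighbourhood basis of `f` in the compact-open topology. -/
theorem exists_forall_comp_eq_mem (hX : IsHHomogeneous X) (f : X ≃ₜ X) {N : Set (X ≃ₜ X)}
    (hN : N ∈ @nhds _ (homeoTop X) f) :
    ∃ (ι : Type u) (q : X → ι), IsLocallyConstant q ∧
      ∀ k : X ≃ₜ X, q ∘ k = q ∘ f → k ∈ N := by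
  let l : Filter (X ≃ₜ X) := ⨅ Q : DiscreteQuotient X, 𝓟 {g | Q.proj ∘ g = Q.proj ∘ f}
  have hl : l ≤ @nhds _ (homeoTop X) f := by
    rw [homeoTop, nhds_induced, ← tendsto_iff_comap, ContinuousMap.tendsto_nhds_compactOpen]
    intro K hK U hU hKU
    have hfK : IsCompact (f '' K) := hK.image f.continuous
    obtain ⟨V, hV, hKV, hVU⟩ : ∃ V : Set X, IsClopen V ∧ f '' K ⊆ V ∧ V ⊆ U := by
      refine hfK.induction_on (p := fun s => ∃ V : Set X, IsClopen V ∧ s ⊆ V ∧ V ⊆ U)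
        ⟨∅, isClopen_empty, Subset.rfl, empty_subset _⟩ ?_ ?_ ?_
      · rintro s s' hs ⟨V, h1, h2, h3⟩
        exact ⟨V, h1, hs.trans h2, h3⟩
      · rintro s s' ⟨V, h1, h2, h3⟩ ⟨V', h1', h2', h3'⟩
        exact ⟨V ∪ V', h1.union h1', union_subset_union h2 h2', union_subset h3 h3'⟩
      · rintro _ ⟨x, hx, rfl⟩
        obtain ⟨V, hV, hxV, hVU⟩ := hX.2.1.exists_subset_of_mem_open (hKU hx) hU
        have hV' : IsClopen V := hV
        exact ⟨V, mem_nhdsWithin_of_mem_nhds (hV'.isOpen.mem_nhds hxV), V, hV', Subset.rfl, hVU⟩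
    refine mem_iInf_of_mem (DiscreteQuotient.ofIsClopen hV) ?_
    intro g hg x hx
    have h1 := Quotient.exact (congrFun hg x)
    exact hVU ((show g x ∈ V ↔ f x ∈ V from h1).2 (hKV ⟨x, hx, rfl⟩))
  have hdir : Directed (· ≥ ·) fun Q : DiscreteQuotient X =>
      𝓟 {g : X ≃ₜ X | Q.proj ∘ g = Q.proj ∘ f} := by
    intro Q R
    have hle : ∀ {S T : DiscreteQuotient X}, S ≤ T →
        𝓟 {g : X ≃ₜ X | S.proj ∘ g = S.proj ∘ f} ≤ 𝓟 {g : X ≃ₜ X | T.proj ∘ g = T.proj ∘ f} := by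
      intro S T hST
      refine principal_mono.2 fun g hg => funext fun x => ?_
      have := congrArg (DiscreteQuotient.ofLE hST) (congrFun hg x)
      simpa using this
    exact ⟨Q ⊓ R, hle inf_le_left, hle inf_le_right⟩
  obtain ⟨Q, hQ⟩ := (mem_iInf_of_directed hdir N).1 (hl hN)
  exact ⟨Q, Q.proj, Q.proj_isLocallyConstant, fun k hk => hQ hk⟩

variable [CompactSpace X] [T2Space X] [Nontrivial X]

/-- Composition of relations: with a factor `k` preserving the partition `q`, the incidence
relation of `g * k * h` contains the composite of those of `h` and `g`. -/
theorem exists_mixing (hX : IsHHomogeneous X) {ι : Type*} {q : X → ι} (hq : IsLocallyConstant q)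
    (g h : X ≃ₜ X) :
    ∃ k : X ≃ₜ X, q ∘ k = q ∧
      ∀ x y, q (h x) = q y → ∃ z, q z = q x ∧ q ((g * k * h) z) = q (g y) := by
  have hp₁ : IsLocallyConstant fun x => (q (h.symm x), q x) :=
    (hq.comp_continuous h.symm.continuous).prodMk hq
  have hp₂ : IsLocallyConstant fun x => (q x, q (g x)) :=
    hq.prodMk (hq.comp_continuous g.continuous)
  let T : Set (ι × ι × ι) := {t | (∃ x, q (h.symm x) = t.1 ∧ q x = t.2.1) ∧
    ∃ y, q y = t.2.1 ∧ q (g y) = t.2.2}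
  have hT : T.Finite := by
    refine (hq.range_finite.prod (hq.range_finite.prod hq.range_finite)).subset ?_
    rintro ⟨i, j, l⟩ ⟨⟨x, h1, h2⟩, y, h3, h4⟩
    exact ⟨⟨_, h1⟩, ⟨_, h2⟩, ⟨_, h4⟩⟩
  obtain ⟨c₁, hc₁, hr₁, he₁⟩ := hX.exists_lift hT hp₁ (fun t => (t.1, t.2.1)) (by
    ext ⟨i, j⟩
    constructor
    · rintro ⟨⟨i', j', l⟩, ⟨⟨x, h1, h2⟩, -⟩, h3⟩
      exact ⟨x, (Prod.ext h1 h2).trans h3⟩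
    · rintro ⟨x, h1⟩
      exact ⟨(q (h.symm x), q x, q (g x)), ⟨⟨x, rfl, rfl⟩, x, rfl, rfl⟩, h1⟩)
  obtain ⟨c₂, hc₂, hr₂, he₂⟩ := hX.exists_lift hT hp₂ (fun t => t.2) (by
    ext ⟨j, l⟩
    constructor
    · rintro ⟨⟨i', j', l'⟩, ⟨-, y, h1, h2⟩, h3⟩
      exact ⟨y, (Prod.ext h1 h2).trans h3⟩
    · rintro ⟨x, h1⟩
      exact ⟨(q (h.symm x), q x, q (g x)), ⟨⟨x, rfl, rfl⟩, x, rfl, rfl⟩, h1⟩)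
  obtain ⟨k, hk, -⟩ := hX.exists_homeomorph_comp_eq hc₁ hc₂ (hr₁.trans hr₂.symm)
  have hk' : ∀ x, (q (k x), q (g (k x))) = (c₁ x).2 := fun x => by rw [← hk, ← he₂]
  refine ⟨k, ?_, fun x y hxy => ?_⟩
  · funext x
    exact (congrArg Prod.fst (hk' x)).trans (congrArg Prod.snd (he₁ x))
  · obtain ⟨w, hw⟩ : (q x, q (h x), q (g y)) ∈ range c₁ := by
      rw [hr₁]
      exact ⟨⟨h x, by simp, rfl⟩, y, hxy.symm, rfl⟩
    refine ⟨h.symm w, ?_, ?_⟩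
    · have := congrArg Prod.fst (he₁ w)
      rw [hw] at this
      exact this.symm
    · have := congrArg Prod.snd (hk' w)
      rw [hw] at this
      change q (g (k (h (h.symm w)))) = _
      rw [h.apply_symm_apply]
      exact this

/-- Every homeomorphism is a quotient of two full ones. -/
theorem exists_isFull_isFull (hX : IsHHomogeneous X) {ι : Type*} {q : X → ι}
    (hq : IsLocallyConstant q) (f : X ≃ₜ X) :
    ∃ h : X ≃ₜ X, IsFull q h ∧ IsFull q (f⁻¹ * h) := by
  have hp : IsLocallyConstant fun x => (q x, q (f.symm x)) :=
    hq.prodMk (hq.comp_continuous f.symm.continuous)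
  have hT : (range q ×ˢ range fun x => (q x, q (f.symm x))).Finite :=
    hq.range_finite.prod hp.range_finite
  obtain ⟨c₁, hc₁, hr₁, he₁⟩ := hX.exists_lift hT hp Prod.snd
    (snd_image_prod (range_nonempty q) _)
  obtain ⟨c₂, hc₂, hr₂, he₂⟩ := hX.exists_lift hT hq Prod.fst
    (fst_image_prod _ (range_nonempty _))
  obtain ⟨h, hh, -⟩ := hX.exists_homeomorph_comp_eq hc₂ hc₁ (hr₂.trans hr₁.symm)
  have key : ∀ x y, ∃ z, q z = q x ∧ q (h z) = q y ∧ q (f.symm (h z)) = q (f.symm y) := by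
    intro x y
    obtain ⟨z, hz⟩ : (q x, q y, q (f.symm y)) ∈ range c₂ := by
      rw [hr₂]
      exact ⟨⟨x, rfl⟩, ⟨y, rfl⟩⟩
    have h1 := he₁ (h z)
    rw [hh, hz] at h1
    have h2 := he₂ z
    rw [hz] at h2
    exact ⟨z, h2.symm, (congrArg Prod.fst h1).symm, (congrArg Prod.snd h1).symm⟩
  refine ⟨h, fun x y => ?_, fun x y => ?_⟩
  · obtain ⟨z, h1, h2, -⟩ := key x y
    exact ⟨z, h1, h2⟩
  · obtain ⟨z, h1, -, h2⟩ := key x (f y)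
    rw [f.symm_apply_apply] at h2
    exact ⟨z, h1, h2⟩

/-- Every nonempty clopen set supports two homeomorphisms which do not commute. -/
theorem exists_not_commute (hX : IsHHomogeneous X) {ι : Type*} {q : X → ι}
    (hq : IsLocallyConstant q) (x : X) :
    ∃ f h : X ≃ₜ X, (∀ y, q y ≠ q x → f y = y) ∧ (∀ y, q y ≠ q x → h y = y) ∧
      f * h ≠ h * f := by
  classical
  obtain ⟨c, hc, hr, he⟩ := hX.exists_lift (S := range q ×ˢ (univ : Set (Fin 3)))
    (hq.range_finite.prod finite_univ) hq Prod.fst (fst_image_prod _ univ_nonempty)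
  have hσ : ∀ a b : Fin 3, ∃ f : X ≃ₜ X,
      (∀ y, c (f y) = Equiv.swap (q x, a) (q x, b) (c y)) ∧ ∀ y, q y ≠ q x → f y = y := by
    intro a b
    set σ := Equiv.swap (q x, a) (q x, b) with hσdef
    have hmem : ∀ i, (q x, i) ∈ range c := fun i => by
      rw [hr]
      exact ⟨⟨x, rfl⟩, mem_univ i⟩
    have hσmem : ∀ s ∈ range c, σ s ∈ range c := by
      intro s hs
      rw [hσdef, Equiv.swap_apply_def]
      split_ifs
      exacts [hmem b, hmem a, hs]
    obtain ⟨f, hf, hfix⟩ := hX.exists_homeomorph_comp_eq (hc.comp σ) hc (by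
      ext s
      constructor
      · rintro ⟨y, rfl⟩
        exact hσmem _ (mem_range_self y)
      · intro hs
        obtain ⟨y, hy⟩ := hσmem s hs
        exact ⟨y, by simp [hy, hσdef]⟩)
    refine ⟨f, hf, fun y hy => hfix y ?_⟩
    have hne : ∀ i, c y ≠ (q x, i) := fun i h => hy (by rw [← he y, h])
    have h1 : σ (c y) = c y := Equiv.swap_apply_of_ne_of_ne (hne a) (hne b)
    ext z
    simp only [Function.comp_apply, mem_preimage, mem_singleton_iff, h1]
    rw [← σ.injective.eq_iff (a := c z), h1]
  obtain ⟨f, hf, hf'⟩ := hσ 0 1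
  obtain ⟨h, hh, hh'⟩ := hσ 1 2
  refine ⟨f, h, hf', hh', fun heq => ?_⟩
  obtain ⟨y, hy⟩ : (q x, (0 : Fin 3)) ∈ range c := by
    rw [hr]
    exact ⟨⟨x, rfl⟩, mem_univ _⟩
  have h1 : c (f (h y)) = c (h (f y)) := congrArg (fun k : X ≃ₜ X => c (k y)) heq
  rw [hf, hh, hh, hf, hy] at h1
  simp [Equiv.swap_apply_def] at h1

section GroupTopology

variable [TopologicalSpace (X ≃ₜ X)] [IsTopologicalGroup (X ≃ₜ X)]

/-- In a Hausdorff group topology, elements close to the identity do not displace any piece of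
a given clopen partition. -/
theorem eventually_forall_exists [T2Space (X ≃ₜ X)] (hX : IsHHomogeneous X) {ι : Type*}
    {q : X → ι} (hq : IsLocallyConstant q) :
    ∀ᶠ g in 𝓝 (1 : X ≃ₜ X), ∀ x, ∃ y, q y = q x ∧ q (g y) = q x := by
  have h1 : ∀ i ∈ range q, ∀ᶠ g in 𝓝 (1 : X ≃ₜ X), ∃ y, q y = i ∧ q (g y) = i := by
    rintro _ ⟨x, rfl⟩
    obtain ⟨f, h, hf, hh, hne⟩ := hX.exists_not_commute hq x
    have hopen : IsOpen {g : X ≃ₜ X | g * f * g⁻¹ * h ≠ h * (g * f * g⁻¹)} :=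
      isOpen_ne_fun (by fun_prop) (by fun_prop)
    filter_upwards [hopen.mem_nhds (by simpa using hne)] with g hg
    by_contra! hcon
    refine hg (Homeomorph.ext fun y => ?_)
    have hdisj : Equiv.Perm.Disjoint (g * f * g⁻¹).toEquiv h.toEquiv := by
      intro y
      by_cases hy : q y = q x
      · left
        have h2 : f (g.symm y) = g.symm y := hf _ fun h3 => hcon _ h3 (by simpa using hy)
        change g (f (g.symm y)) = y
        rw [h2, g.apply_symm_apply]
      · exact Or.inr (hh y hy)
    exact congrArg (fun p : Equiv.Perm X => p y) hdisj.commute.eq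
  filter_upwards [(eventually_all_finite hq.range_finite).2 h1] with g hg x
  exact hg _ (mem_range_self x)

/-- If elements arbitrarily close to the identity move some partition, then they move any given
clopen set onto a set meeting any other given one. -/
theorem frequently_exists (hX : IsHHomogeneous X) {κ : Type*} {p : X → κ}
    (hp : IsLocallyConstant p) (hfreq : ∃ᶠ k : X ≃ₜ X in 𝓝 1, p ∘ k ≠ p)
    {ι : Type*} {q : X → ι} (hq : IsLocallyConstant q) (a b : X) :
    ∃ᶠ k : X ≃ₜ X in 𝓝 1, ∃ x, q x = q a ∧ q (k x) = q b := by
  classical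
  obtain ⟨c, hc, hr, he⟩ := hX.exists_lift (S := range p ×ˢ (univ : Set Bool))
    (hp.range_finite.prod finite_univ) hp Prod.fst (fst_image_prod _ univ_nonempty)
  obtain ⟨α, hα, β, hβ, hαβ, hfr⟩ : ∃ α ∈ range c, ∃ β ∈ range c, α.1 ≠ β.1 ∧
      ∃ᶠ k : X ≃ₜ X in 𝓝 1, ∃ x, c x = α ∧ c (k x) = β := by
    by_contra! hcon
    refine hfreq ?_
    have h1 : ∀ α ∈ range c, ∀ β ∈ range c, ∀ᶠ k : X ≃ₜ X in 𝓝 1,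
        α.1 ≠ β.1 → ∀ x, ¬ (c x = α ∧ c (k x) = β) := by
      intro α hα β hβ
      by_cases h : α.1 = β.1
      · exact Eventually.of_forall fun _ h' => absurd h h'
      · have h2 := hcon α hα β hβ h
        filter_upwards [h2] with k hk _ x hx
        exact hk x hx.1 hx.2
    have h2 := (eventually_all_finite hc.range_finite).2 fun α hα =>
      (eventually_all_finite hc.range_finite).2 (h1 α hα)
    filter_upwards [h2] with k hk
    rw [not_not]
    funext x
    by_contra hne
    refine hk _ (mem_range_self x) _ (mem_range_self (k x)) ?_ x ⟨rfl, rfl⟩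
    rw [he, he]
    exact fun h => hne h.symm
  obtain ⟨c', hc', hr', he'⟩ := hX.exists_lift (S := range q ×ˢ (univ : Set (Fin 3)))
    (hq.range_finite.prod finite_univ) hq Prod.fst (fst_image_prod _ univ_nonempty)
  let ρ : κ × Bool → Fin 3 := fun s => if s = α then 0 else if s = β then 1 else 2
  let π : ι × Fin 3 → Fin 3 := fun s =>
    if s = (q a, 0) then 0 else if s = (q b, 1) then 1 else 2
  have hρ : range (ρ ∘ c) = univ := by
    rw [eq_univ_iff_forall]
    have hne : β ≠ α := fun h => hαβ (by rw [h])
    intro i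
    fin_cases i
    · obtain ⟨x, hx⟩ := hα
      exact ⟨x, by simp [ρ, hx]⟩
    · obtain ⟨x, hx⟩ := hβ
      exact ⟨x, by simp [ρ, hx, hne]⟩
    · obtain ⟨x, hx⟩ : (α.1, !α.2) ∈ range c := by
        rw [hr] at hα ⊢
        exact ⟨hα.1, mem_univ _⟩
      refine ⟨x, ?_⟩
      have h1 : (α.1, !α.2) ≠ α := fun h => by
        have := congrArg Prod.snd h
        simp at this
      have h2 : (α.1, !α.2) ≠ β := fun h => hαβ (by rw [← h])
      simp [ρ, hx, h1, h2]
  have hπ : range (π ∘ c') = univ := by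
    rw [eq_univ_iff_forall]
    have hmem : ∀ x i, (q x, i) ∈ range c' := fun x i => by
      rw [hr']
      exact ⟨⟨x, rfl⟩, mem_univ i⟩
    intro i
    fin_cases i
    · obtain ⟨x, hx⟩ := hmem a 0
      exact ⟨x, by simp [π, hx]⟩
    · obtain ⟨x, hx⟩ := hmem b 1
      exact ⟨x, by simp [π, hx]⟩
    · obtain ⟨x, hx⟩ := hmem a 2
      exact ⟨x, by simp [π, hx]⟩
  obtain ⟨f, hf, -⟩ := hX.exists_homeomorph_comp_eq (hc.comp ρ) (hc'.comp π) (hρ.trans hπ.symm)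
  have hπ0 : ∀ s, π s = 0 → s.1 = q a := by
    intro s hs
    by_cases h1 : s = (q a, 0)
    · rw [h1]
    · by_cases h2 : s = (q b, 1) <;> simp [π, h1, h2] at hs
  have hπ1 : ∀ s, π s = 1 → s.1 = q b := by
    intro s hs
    by_cases h2 : s = (q b, 1)
    · rw [h2]
    · by_cases h1 : s = (q a, 0) <;> simp [π, h1, h2] at hs
  have hfa : ∀ x, c x = α → q (f x) = q a := fun x hx => by
    rw [← he']
    refine hπ0 _ ((hf x).trans ?_)
    simp [ρ, hx]
  have hfb : ∀ x, c x = β → q (f x) = q b := fun x hx => by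
    rw [← he']
    refine hπ1 _ ((hf x).trans ?_)
    have hne : β ≠ α := fun h => hαβ (by rw [h])
    simp [ρ, hx, hne]
  have hconj : Tendsto (fun k => f * k * f⁻¹) (𝓝 (1 : X ≃ₜ X)) (𝓝 1) := by
    have : Continuous fun k : X ≃ₜ X => f * k * f⁻¹ := by fun_prop
    simpa using this.tendsto 1
  refine hconj.frequently (hfr.mono ?_)
  rintro k ⟨x, hx1, hx2⟩
  refine ⟨f x, hfa x hx1, ?_⟩
  change q (f (k (f.symm (f x)))) = q b
  rw [f.symm_apply_apply]
  exact hfb _ hx2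

/-- If elements arbitrarily close to the identity move some partition, then there are full
elements arbitrarily close to the identity. -/
theorem frequently_isFull [T2Space (X ≃ₜ X)] (hX : IsHHomogeneous X)
    (hbasis : ∀ N ∈ 𝓝 (1 : X ≃ₜ X), ∃ (ι : Type u) (q : X → ι), IsLocallyConstant q ∧
      ∀ k : X ≃ₜ X, q ∘ k = q → k ∈ N)
    {κ : Type*} {p : X → κ}
    (hp : IsLocallyConstant p) (hfreq : ∃ᶠ k : X ≃ₜ X in 𝓝 1, p ∘ k ≠ p)
    {ι : Type*} {q : X → ι} (hq : IsLocallyConstant q) :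
    ∃ᶠ k : X ≃ₜ X in 𝓝 1, IsFull q k := by
  have key : ∀ E : Set (ι × ι), E.Finite → E ⊆ range q ×ˢ range q →
      ∃ᶠ k : X ≃ₜ X in 𝓝 1, ∀ e ∈ E, ∃ x, q x = e.1 ∧ q (k x) = e.2 := by
    intro E hE
    induction E, hE using Set.Finite.induction_on with
    | empty => exact fun _ => (Eventually.of_forall (by simp)).frequently
    | @insert e E _ _ ih =>
      intro hsub
      have ih := ih ((subset_insert _ _).trans hsub)
      obtain ⟨⟨a, ha⟩, ⟨b, hb⟩⟩ := hsub (mem_insert _ _)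
      rw [frequently_iff]
      intro N hN
      obtain ⟨M, hM, hMN⟩ := exists_nhds_one_split4 hN
      obtain ⟨ι', q₀, hq₀, hq₀M⟩ := hbasis M hM
      have hq₁ : IsLocallyConstant fun x => (q x, q₀ x) := hq.prodMk hq₀
      have hdiag := hX.eventually_forall_exists hq₁
      obtain ⟨g, hgE, hgd, hgM⟩ := (ih.and_eventually (hdiag.and hM)).exists
      obtain ⟨h, ⟨x, hxa, hxb⟩, hhd, hhM⟩ :=
        ((hX.frequently_exists hp hfreq hq a b).and_eventually (hdiag.and hM)).exists
      obtain ⟨k, hk, hmix⟩ := hX.exists_mixing hq₁ g h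
      have hkM : k ∈ M := hq₀M k (funext fun z => congrArg Prod.snd (congrFun hk z))
      refine ⟨g * k * h, by simpa using hMN hgM hkM hhM (mem_of_mem_nhds hM), ?_⟩
      rintro e' (rfl | he')
      · obtain ⟨y, hy1, hy2⟩ := hgd (h x)
        obtain ⟨z, hz1, hz2⟩ := hmix x y hy1.symm
        exact ⟨z, (congrArg Prod.fst hz1).trans (hxa.trans ha),
          (congrArg Prod.fst (hz2.trans hy2)).trans (hxb.trans hb)⟩
      · obtain ⟨y, hy1, hy2⟩ := hgE e' he'
        obtain ⟨x', hx1, hx2⟩ := hhd y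
        obtain ⟨z, hz1, hz2⟩ := hmix x' y hx2
        exact ⟨z, (congrArg Prod.fst (hz1.trans hx1)).trans hy1,
          (congrArg Prod.fst hz2).trans hy2⟩
  refine (key _ (hq.range_finite.prod hq.range_finite) Subset.rfl).mono fun k hk x y => ?_
  exact hk (q x, q y) ⟨⟨x, rfl⟩, ⟨y, rfl⟩⟩

/-- In a Hausdorff group topology in which every neighbourhood of the identity contains the
stabilizer of a clopen partition, all such stabilizers are neighbourhoods of the identity. -/
theorem eventually_comp_eq [T2Space (X ≃ₜ X)] (hX : IsHHomogeneous X)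
    (hbasis : ∀ N ∈ 𝓝 (1 : X ≃ₜ X), ∃ (ι : Type u) (q : X → ι), IsLocallyConstant q ∧
      ∀ k : X ≃ₜ X, q ∘ k = q → k ∈ N)
    {κ : Type*} {p : X → κ} (hp : IsLocallyConstant p) :
    ∀ᶠ k : X ≃ₜ X in 𝓝 1, p ∘ k = p := by
  by_contra hcon
  have hfreq : ∃ᶠ k : X ≃ₜ X in 𝓝 1, p ∘ k ≠ p := not_eventually.1 hcon
  have hall : ∀ f : X ≃ₜ X, ∀ N ∈ 𝓝 (1 : X ≃ₜ X), f ∈ N := by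
    intro f N hN
    obtain ⟨L, hL, hLN⟩ := exists_nhds_split_inv hN
    obtain ⟨M, hM, hML⟩ := exists_nhds_one_split4 hL
    obtain ⟨ι, q, hq, hqM⟩ := hbasis M hM
    obtain ⟨g, hg, hgM⟩ := ((hX.frequently_isFull hbasis hp hfreq hq).and_eventually hM).exists
    have hfull : ∀ h : X ≃ₜ X, IsFull q h → h ∈ L := by
      intro h hh
      obtain ⟨a, b, ha, hb, rfl⟩ := hX.exists_eq_mul_mul hq h g (hh.range_eq.trans hg.range_eq.symm)
      simpa using hML (hqM a ha) hgM (hqM b hb) (mem_of_mem_nhds hM)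
    obtain ⟨h, hh1, hh2⟩ := hX.exists_isFull_isFull hq f
    have := hLN h (hfull h hh1) (f⁻¹ * h) (hfull _ hh2)
    simpa [div_eq_mul_inv] using this
  obtain ⟨f, hf⟩ := hfreq.exists
  have hf1 : f ≠ 1 := by
    rintro rfl
    exact hf rfl
  exact hall f _ (isOpen_ne.mem_nhds hf1.symm) rfl

end GroupTopology

end IsHHomogeneous

/-- The group of self-homeomorphisms of an h-homogeneous compact Hausdorff space,
with the compact-open topology, is a minimal topological group: every Hausdorff group
topology on it which is coarser than the compact-open topology coincides with it. -/
theorem minimal_of_isHHomogeneous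
    {X : Type*} [TopologicalSpace X] [CompactSpace X] [T2Space X]
    (hX : IsHHomogeneous X)
    (t : TopologicalSpace (X ≃ₜ X))
    (ht2 : @T2Space (X ≃ₜ X) t)
    (htg : @IsTopologicalGroup (X ≃ₜ X) t (homeoGroup X))
    (hcoarser : homeoTop X ≤ t) :
    t = homeoTop X := by
  rcases subsingleton_or_nontrivial X with hsub | hnt
  · have : Subsingleton (X ≃ₜ X) := ⟨fun f g => Homeomorph.ext fun x => Subsingleton.elim _ _⟩
    exact Subsingleton.elim _ _
  refine le_antisymm ?_ hcoarser
  rw [le_iff_nhds]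
  intro f N hN
  obtain ⟨ι, q, hq, hqN⟩ := hX.exists_forall_comp_eq_mem f hN
  have hbasis : ∀ N ∈ @nhds _ t (1 : X ≃ₜ X), ∃ (ι : Type _) (q : X → ι), IsLocallyConstant q ∧
      ∀ k : X ≃ₜ X, q ∘ k = q → k ∈ N := fun N hN =>
    hX.exists_forall_comp_eq_mem 1 (nhds_mono hcoarser hN)
  have h1 := hX.eventually_comp_eq hbasis hq
  have h2 : Tendsto (fun g : X ≃ₜ X => g * f⁻¹) (@nhds _ t f) (@nhds _ t 1) := by
    have : Continuous[t, t] fun g : X ≃ₜ X => g * f⁻¹ := continuous_mul_const _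
    simpa using this.tendsto f
  filter_upwards [h2.eventually h1] with g hg
  refine hqN g (funext fun x => ?_)
  have h3 : q (g (f.symm (f x))) = q (f x) := congrFun hg (f x)
  rwa [f.symm_apply_apply] at h3
end

section
/- Let X be an h-homogeneous compact Hausdorff space, let γ = {U_α : α ∈ A} be a finite partition of X into nonempty clopen sets, and let r ⊆ A × A be a relation with Dom r = Ran r = A. Then there exists a self-homeomorphism f of X such that M(γ, f) = r, i.e. for all α, β ∈ A one has f(U_α) ∩ U_β ≠ ∅ if and only if (α, β) ∈ r. -/
open Set TopologicalSpace Filter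
open scoped Function

/-- In a totally separated space, finitely many distinct points can be labelled by a locally
constant function. -/
theorem exists_isLocallyConstant_leftInverse {X E : Type*} [TopologicalSpace X]
    [TotallySeparatedSpace X] [Finite E] [Nonempty E] {g : E → X} (hg : Function.Injective g) :
    ∃ p : X → E, IsLocallyConstant p ∧ ∀ e, p (g e) = e := by
  have hsep : ∀ i j : E, ∃ C : Set X, IsClopen C ∧ (i ≠ j → g i ∈ C ∧ g j ∉ C) := by
    intro i j
    by_cases hij : i = j
    · exact ⟨∅, isClopen_empty, fun h => absurd hij h⟩
    · obtain ⟨C, hC, hi, hj⟩ := exists_isClopen_of_totally_separated (hg.ne hij)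
      exact ⟨C, hC, fun _ => ⟨hi, hj⟩⟩
  choose C hC hCsep using hsep
  classical
  let F : X → E → E → Bool := fun x i j => decide (x ∈ C i j)
  have hF : IsLocallyConstant F := by
    refine (IsLocallyConstant.iff_continuous F).2 (continuous_pi fun i => continuous_pi fun j => ?_)
    refine (continuous_bool_rng true).2 ?_
    convert hC i j using 1
    ext x
    simp [F]
  have hinj : Function.Injective (F ∘ g) := by
    intro i j hij
    by_contra hne
    have h := congrFun (congrFun hij i) j
    simp [F, hCsep i j hne] at h
  exact ⟨Function.invFun (F ∘ g) ∘ F, hF.comp _, Function.leftInverse_invFun hinj⟩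

/-- A finite clopen partition into infinite pieces can be refined to a partition by nonempty
clopen sets indexed by any finite type `E` over the index type. -/
theorem exists_isLocallyConstant_refinement {X A E : Type*} [TopologicalSpace X]
    [TotallySeparatedSpace X] [Finite E] {U : A → Set X}
    (hopen : ∀ a, IsOpen (U a)) (hinf : ∀ a, (U a).Infinite)
    (hdisj : Pairwise (Disjoint on U)) (hcover : ⋃ a, U a = Set.univ)
    {π : E → A} (hπ : Function.Surjective π) :
    ∃ p : X → E, IsLocallyConstant p ∧ Function.Surjective p ∧ ∀ x, x ∈ U (π (p x)) := by
  have hunique : ∀ {x a b}, x ∈ U a → x ∈ U b → a = b := fun {x a b} ha hb => by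
    by_contra hab
    exact Set.disjoint_left.1 (hdisj hab) ha hb
  rcases isEmpty_or_nonempty X with hX | ⟨⟨x₀⟩⟩
  · have hA : IsEmpty A := ⟨fun a => isEmptyElim (hinf a).nonempty.some⟩
    exact ⟨isEmptyElim, IsLocallyConstant.of_discrete _, fun e => isEmptyElim (π e), isEmptyElim⟩
  have hclass : ∀ x, ∃ a, x ∈ U a := fun x => Set.mem_iUnion.1 (hcover ▸ Set.mem_univ x)
  choose c hc using hclass
  have : Nonempty E := ⟨(hπ (c x₀)).choose⟩
  have hcloc : IsLocallyConstant c := by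
    rw [IsLocallyConstant.iff_exists_open]
    exact fun x => ⟨U (c x), hopen _, hc x, fun y hy => hunique (hc y) hy⟩
  have hemb : ∀ a, Nonempty (E ↪ U a) := fun a => by
    have := (hinf a).to_subtype
    cases nonempty_fintype E
    exact ⟨Function.Embedding.trans (Fintype.equivFin E).toEmbedding
      (Fin.valEmbedding.trans (Infinite.natEmbedding (U a)))⟩
  let j : ∀ a, E ↪ U a := fun a => (hemb a).some
  let g : E → X := fun e => j (π e) e
  have hgU : ∀ e, g e ∈ U (π e) := fun e => (j (π e) e).2
  have hg : Function.Injective g := by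
    intro e e' h
    have hee : π e = π e' := hunique (hgU e) (h ▸ hgU e')
    dsimp only [g] at h
    generalize π e = a at h hee
    subst hee
    exact (j (π e')).injective (Subtype.ext h)
  obtain ⟨q, hq, hqg⟩ := exists_isLocallyConstant_leftInverse hg
  classical
  let k : E × A → E := fun z => if π z.1 = z.2 then z.1 else Function.surjInv hπ z.2
  have hk : ∀ z, π (k z) = z.2 := by
    intro z
    by_cases h : π z.1 = z.2
    · simp [k, h]
    · simp [k, h, Function.surjInv_eq hπ]
  refine ⟨fun x => k (q x, c x), (hq.prodMk hcloc).comp k, fun e => ⟨g e, ?_⟩, fun x => ?_⟩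
  · have hce : π e = c (g e) := hunique (hgU e) (hc _)
    simp [k, hqg, hce]
  · rw [hk]
    exact hc x

/-- Continuity can be checked on the fibers of a locally constant function. -/
theorem continuous_of_domRestrict_fibers {X Y E : Type*} [TopologicalSpace X] [TopologicalSpace Y]
    {p : X → E} (hp : IsLocallyConstant p) {f : X → Y}
    (hf : ∀ e, Continuous ((p ⁻¹' {e}).domRestrict f)) : Continuous f := by
  rw [continuous_iff_continuousAt]
  intro x
  exact (continuousOn_iff_continuous_domRestrict.2 (hf (p x))).continuousAt
    ((hp.isOpen_fiber (p x)).mem_nhds rfl)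

/-- Two locally constant functions with homeomorphic fibers differ by a homeomorphism. -/
theorem exists_homeomorph_comp_eq {X Y E : Type*} [TopologicalSpace X] [TopologicalSpace Y]
    {p : X → E} {q : Y → E} (hp : IsLocallyConstant p) (hq : IsLocallyConstant q)
    (h : ∀ e, Nonempty ((p ⁻¹' {e} : Set X) ≃ₜ (q ⁻¹' {e} : Set Y))) :
    ∃ f : X ≃ₜ Y, ∀ x, q (f x) = p x := by
  let φ : ∀ e, (p ⁻¹' {e} : Set X) ≃ₜ (q ⁻¹' {e} : Set Y) := fun e => (h e).some
  have hφ : ∀ e x, q (φ e x) = e := fun e x => (φ e x).2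
  refine ⟨⟨⟨fun x => φ (p x) ⟨x, rfl⟩, fun y => (φ (q y)).symm ⟨y, rfl⟩, fun x => ?_,
    fun y => ?_⟩, ?_, ?_⟩, fun x => hφ _ _⟩
  · have key : ∀ (e) (z : (q ⁻¹' {e} : Set Y)),
        ((φ (q z)).symm ⟨z, rfl⟩ : X) = (φ e).symm z := by
      rintro _ ⟨z, rfl⟩
      rfl
    simp [key]
  · have key : ∀ (e) (z : (p ⁻¹' {e} : Set X)), (φ (p z) ⟨z, rfl⟩ : Y) = φ e z := by
      rintro _ ⟨z, rfl⟩
      rfl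
    simp [key]
  · refine continuous_of_domRestrict_fibers hp fun e => ?_
    convert continuous_subtype_val.comp (φ e).continuous using 1
    ext ⟨x, rfl⟩
    rfl
  · refine continuous_of_domRestrict_fibers hq fun e => ?_
    convert continuous_subtype_val.comp (φ e).symm.continuous using 1
    ext ⟨y, rfl⟩
    rfl

/-- An h-homogeneous Hausdorff space with more than one point is infinite. -/
theorem IsHHomogeneous.infinite {X : Type*} [TopologicalSpace X] [T2Space X] [Nontrivial X]
    (hX : IsHHomogeneous X) : Infinite X := by
  by_contra hfin
  rw [not_infinite_iff_finite] at hfin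
  obtain ⟨x⟩ := hX.1
  obtain ⟨φ⟩ := hX.2.2 {x} Set.univ (isClopen_discrete _) isClopen_univ
    (Set.singleton_nonempty x) Set.univ_nonempty
  have hsub : Subsingleton (Set.univ : Set X) := φ.symm.injective.subsingleton
  exact not_subsingleton X ((Equiv.Set.univ X).symm.injective.subsingleton)

/-- Let `X` be an h-homogeneous compact Hausdorff space, `γ = {U a : a ∈ A}` a finite
partition of `X` into nonempty clopen sets, and `r ⊆ A × A` a relation with full domain
and range. Then there is a self-homeomorphism `f` of `X` with `M(γ, f) = r`, i.e.
`f(U a) ∩ U b ≠ ∅ ↔ (a, b) ∈ r`. -/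
theorem exists_homeomorph_M_eq
    {X : Type*} [TopologicalSpace X] [CompactSpace X] [T2Space X]
    (hX : IsHHomogeneous X)
    {A : Type*} [Finite A] (U : A → Set X)
    (hclopen : ∀ a, IsClopen (U a)) (hne : ∀ a, (U a).Nonempty)
    (hdisj : Pairwise (Disjoint on U)) (hcover : ⋃ a, U a = Set.univ)
    (r : Set (A × A))
    (hdom : ∀ a, ∃ b, (a, b) ∈ r) (hran : ∀ b, ∃ a, (a, b) ∈ r) :
    ∃ f : X ≃ₜ X, ∀ a b, (f '' U a ∩ U b).Nonempty ↔ (a, b) ∈ r := by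
  have hunique : ∀ {x a b}, x ∈ U a → x ∈ U b → a = b := fun {x a b} ha hb => by
    by_contra hab
    exact Set.disjoint_left.1 (hdisj hab) ha hb
  rcases subsingleton_or_nontrivial X with hsub | hnt
  · have hA : ∀ a b : A, a = b := fun a b => by
      obtain ⟨x, hx⟩ := hne a
      obtain ⟨y, hy⟩ := hne b
      exact hunique hx (Subsingleton.elim y x ▸ hy)
    refine ⟨Homeomorph.refl X, fun a b => ⟨fun _ => ?_, fun _ => ?_⟩⟩
    · obtain ⟨b', hb'⟩ := hdom a
      rwa [hA b b']
    · obtain rfl := hA a b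
      simpa using hne a
  have hXinf : Infinite X := hX.infinite
  have hinf : ∀ a, (U a).Infinite := fun a => by
    obtain ⟨φ⟩ := hX.2.2 (U a) Set.univ (hclopen a) isClopen_univ (hne a) Set.univ_nonempty
    exact Set.infinite_coe_iff.1
      ((φ.toEquiv.trans (Equiv.Set.univ X)).infinite_iff.2 hXinf)
  have hsep : TotallySeparatedSpace X := by
    rw [totallySeparatedSpace_iff_exists_isClopen]
    intro x y hxy
    obtain ⟨C, hC, hx, hCy⟩ := hX.2.1.exists_subset_of_mem_open (u := {y}ᶜ) hxy
      isOpen_compl_singleton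
    exact ⟨C, hC, hx, fun hy => hCy hy rfl⟩
  have hopen := fun a => (hclopen a).isOpen
  obtain ⟨p, hp, hpsurj, hpU⟩ := exists_isLocallyConstant_refinement hopen hinf hdisj hcover
    (π := fun e : r => e.1.1) (fun a => (hdom a).elim fun b h => ⟨⟨(a, b), h⟩, rfl⟩)
  obtain ⟨q, hq, hqsurj, hqU⟩ := exists_isLocallyConstant_refinement hopen hinf hdisj hcover
    (π := fun e : r => e.1.2) (fun b => (hran b).elim fun a h => ⟨⟨(a, b), h⟩, rfl⟩)
  obtain ⟨f, hf⟩ := exists_homeomorph_comp_eq hp hq fun e =>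
    hX.2.2 _ _ (hp.isClopen_fiber e) (hq.isClopen_fiber e) (hpsurj e) (hqsurj e)
  refine ⟨f, fun a b => ⟨?_, fun hab => ?_⟩⟩
  · rintro ⟨_, ⟨x, hxa, rfl⟩, hxb⟩
    have ha : a = (p x).1.1 := hunique hxa (hpU x)
    have hb : b = (p x).1.2 := hunique hxb (hf x ▸ hqU (f x))
    rw [ha, hb]
    exact (p x).2
  · obtain ⟨x, hx⟩ := hpsurj ⟨(a, b), hab⟩
    have hxa := hpU x
    have hxb := hqU (f x)
    rw [hf, hx] at hxb
    rw [hx] at hxa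
    exact ⟨f x, ⟨x, hxa, rfl⟩, hxb⟩
end

section
/- Let X be an h-homogeneous compact Hausdorff space, let γ = {U_α : α ∈ A} be a finite partition of X into nonempty clopen sets, and let V_γ = {h ∈ Aut(X) : h(U_α) = U_α for every α ∈ A}. If f, g ∈ Aut(X) satisfy M(γ, f) = M(γ, g) (i.e. for all α, β ∈ A, f(U_α) ∩ U_β ≠ ∅ iff g(U_α) ∩ U_β ≠ ∅), then f ∈ V_γ · g · V_γ, i.e. there exist u, v ∈ V_γ with f = u ∘ g ∘ v. -/
open Set TopologicalSpace Filter

/-- A map is continuous if its restriction to each fibre of a continuous map to a discrete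
space is continuous. -/
theorem continuous_of_continuous_domRestrict_fiber {X Y I : Type*} [TopologicalSpace X]
    [TopologicalSpace Y] [TopologicalSpace I] [DiscreteTopology I] {p : X → I}
    (hp : Continuous p) {F : X → Y} (hF : ∀ i, Continuous ((p ⁻¹' {i}).domRestrict F)) :
    Continuous F := by
  refine continuous_iff_continuousAt.2 fun x => ?_
  have hopen : IsOpen (p ⁻¹' {p x}) := (isOpen_discrete _).preimage hp
  exact (continuousOn_iff_continuous_domRestrict.2 (hF (p x))).continuousAt (hopen.mem_nhds rfl)

/-- Homeomorphisms between the corresponding fibres of two continuous maps to a discrete space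
glue to a homeomorphism of the total spaces. -/
theorem exists_homeomorph_of_fiber_homeomorph {X Y I : Type*} [TopologicalSpace X]
    [TopologicalSpace Y] [TopologicalSpace I] [DiscreteTopology I] {p : X → I} {q : Y → I}
    (hp : Continuous p) (hq : Continuous q)
    (h : ∀ i, Nonempty ((p ⁻¹' {i} : Set X) ≃ₜ (q ⁻¹' {i} : Set Y))) :
    ∃ v : X ≃ₜ Y, ∀ x, q (v x) = p x := by
  let e := fun i => (h i).some
  let F : X → Y := fun x => e (p x) ⟨x, rfl⟩
  let G : Y → X := fun y => (e (q y)).symm ⟨y, rfl⟩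
  have hF : ∀ i (x : (p ⁻¹' {i} : Set X)), F x = e i x := by
    rintro _ ⟨x, rfl⟩
    rfl
  have hG : ∀ i (y : (q ⁻¹' {i} : Set Y)), G y = (e i).symm y := by
    rintro _ ⟨y, rfl⟩
    rfl
  refine ⟨⟨⟨F, G, fun x => ?_, fun y => ?_⟩, ?_, ?_⟩, fun x => (e (p x) ⟨x, rfl⟩).2⟩
  · simpa using hG (p x) (e (p x) ⟨x, rfl⟩)
  · simpa using hF (q y) ((e (q y)).symm ⟨y, rfl⟩)
  · refine continuous_of_continuous_domRestrict_fiber hp fun i => ?_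
    exact (continuous_subtype_val.comp (e i).continuous).congr fun x => (hF i x).symm
  · refine continuous_of_continuous_domRestrict_fiber hq fun i => ?_
    exact (continuous_subtype_val.comp (e i).symm.continuous).congr fun y => (hG i y).symm

/-- A homeomorphism preserving a labelling preserves each of its fibres. -/
theorem image_eq_of_label_eq {X A : Type*} [TopologicalSpace X] {U : A → Set X} {k : X → A}
    (hk : ∀ x a, k x = a ↔ x ∈ U a) (w : X ≃ₜ X) (hw : ∀ x, k (w x) = k x) (a : A) :
    w '' U a = U a := by
  ext y
  rw [w.image_eq_preimage_symm, mem_preimage, ← hk, ← hk, ← hw, w.apply_symm_apply]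

/-- Let `X` be an h-homogeneous compact Hausdorff space and `γ = {U a : a ∈ A}` a finite
partition of `X` into nonempty clopen sets. If `f, g` are self-homeomorphisms of `X`
meeting the same `γ`-rectangles (`M(γ,f) = M(γ,g)`), then `f = u ∘ g ∘ v` for some
homeomorphisms `u, v` that map each `U a` onto itself. -/
theorem mem_VgV_of_M_eq
    {X : Type*} [TopologicalSpace X] [CompactSpace X] [T2Space X]
    (hX : IsHHomogeneous X)
    {A : Type*} [Finite A] (U : A → Set X)
    (hclopen : ∀ a, IsClopen (U a)) (hne : ∀ a, (U a).Nonempty)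
    (hdisj : Pairwise (Function.onFun Disjoint U)) (hcover : ⋃ a, U a = Set.univ)
    (f g : X ≃ₜ X)
    (hM : ∀ a b, (f '' U a ∩ U b).Nonempty ↔ (g '' U a ∩ U b).Nonempty) :
    ∃ u v : X ≃ₜ X, (∀ a, u '' U a = U a) ∧ (∀ a, v '' U a = U a) ∧
      ∀ x, f x = u (g (v x)) := by
  obtain ⟨-, -, hhom⟩ := hX
  choose k hkU using fun x => mem_iUnion.1 (hcover ▸ mem_univ x)
  have hk : ∀ x a, k x = a ↔ x ∈ U a := fun x a =>
    ⟨fun h => h ▸ hkU x, fun h => by_contra fun hka => (hdisj hka).le_bot ⟨hkU x, h⟩⟩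
  let : TopologicalSpace A := ⊥
  have : DiscreteTopology A := ⟨rfl⟩
  have hkc : Continuous k := continuous_discrete_rng.2 fun a => by
    convert (hclopen a).isOpen using 1
    ext x
    exact hk x a
  have hpair (w : X ≃ₜ X) : Continuous fun x => (k x, k (w x)) :=
    hkc.prodMk (hkc.comp w.continuous)
  have hfib (w : X ≃ₜ X) (a b : A) :
      (w '' U a ∩ U b).Nonempty ↔ ((fun x => (k x, k (w x))) ⁻¹' {(a, b)}).Nonempty := by
    constructor
    · rintro ⟨_, ⟨x, hx, rfl⟩, hb⟩
      exact ⟨x, Prod.ext ((hk _ _).2 hx) ((hk _ _).2 hb)⟩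
    · rintro ⟨x, hx⟩
      obtain ⟨ha, hb⟩ := Prod.ext_iff.1 hx
      exact ⟨w x, mem_image_of_mem w ((hk _ _).1 ha), (hk _ _).1 hb⟩
  obtain ⟨v, hv⟩ := exists_homeomorph_of_fiber_homeomorph (hpair f) (hpair g) fun ⟨a, b⟩ => by
    have hiff := (hfib f a b).symm.trans ((hM a b).trans (hfib g a b))
    rcases eq_empty_or_nonempty ((fun x => (k x, k (f x))) ⁻¹' {(a, b)}) with h | h
    · have h' := not_nonempty_iff_eq_empty.1 (mt hiff.2 (not_nonempty_iff_eq_empty.2 h))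
      exact ⟨(Homeomorph.setCongr h).trans (Homeomorph.setCongr h').symm⟩
    · exact hhom _ _ ((isClopen_discrete _).preimage (hpair f))
        ((isClopen_discrete _).preimage (hpair g)) h (hiff.1 h)
  refine ⟨(g.symm.trans v.symm).trans f, v, image_eq_of_label_eq hk _ fun x => ?_,
    image_eq_of_label_eq hk v fun x => (Prod.ext_iff.1 (hv x)).1, fun x => by simp⟩
  simpa using (Prod.ext_iff.1 (hv (v.symm (g.symm x)))).2.symm
end

section
/- Let X be an h-homogeneous compact Hausdorff space, let λ = {U_α : α ∈ A} be a finite partition of X into nonempty clopen sets, and let r, s ⊆ A × A be relations with Dom r = Ran r = A and Dom s = Ran s = A. Then there exist self-homeomorphisms f, g of X such that M(λ, f) = r, M(λ, g) = s, and M(λ, f ∘ g) = rs, where rs = {(α,β) : ∃γ ∈ A, (α,γ) ∈ s and (γ,β) ∈ r}. -/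
open Set TopologicalSpace Filter
open scoped Function

/-- Composition of relations: `relComp R S = {(x,y) : ∃ z, (x,z) ∈ S ∧ (z,y) ∈ R}`. -/
def relComp {K : Type*} (R S : Set (K × K)) : Set (K × K) :=
  {p | ∃ z, (p.1, z) ∈ S ∧ (z, p.2) ∈ R}

/-- `M(γ, R)`: the set of pairs of indices `(a, b)` such that the relation `R` meets the
rectangle `U a × U b` of the partition `γ = {U a}`. -/
def MRel {X A : Type*} (U : A → Set X) (R : Set (X × X)) : Set (A × A) :=
  {q | (R ∩ (U q.1 ×ˢ U q.2)).Nonempty}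

/-- A nontrivial h-homogeneous Hausdorff space has no isolated points. -/
theorem IsHHomogeneous.neBot_nhdsNE {X : Type*} [TopologicalSpace X] [T2Space X]
    [Nontrivial X] (hX : IsHHomogeneous X) (x : X) : (nhdsWithin x {x}ᶜ).NeBot := by
  by_contra h
  rw [Filter.not_neBot, ← isOpen_singleton_iff_punctured_nhds] at h
  obtain ⟨e⟩ := hX.2.2 {x} Set.univ ⟨isClosed_singleton, h⟩ isClopen_univ
    (singleton_nonempty x) univ_nonempty
  obtain ⟨y, z, hyz⟩ := exists_pair_ne X
  have := e.symm.injective (Subsingleton.elim (e.symm ⟨y, trivial⟩) (e.symm ⟨z, trivial⟩))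
  exact hyz (congrArg Subtype.val this)

/-- In a nontrivial h-homogeneous Hausdorff space, a locally constant map `p` onto `A` lifts
along every surjection `π : T → A` from a finite type to a locally constant map onto `T`. -/
theorem IsHHomogeneous.exists_surjective_lift {X : Type*} [TopologicalSpace X] [T2Space X]
    [Nontrivial X] (hX : IsHHomogeneous X) {A T : Type*} [Finite T] {p : X → A}
    (hp : IsLocallyConstant p) (hps : Function.Surjective p) {π : T → A}
    (hπ : Function.Surjective π) :
    ∃ q : X → T, IsLocallyConstant q ∧ Function.Surjective q ∧ ∀ x, π (q x) = p x := by
  classical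
  have hinf (a : A) : Infinite (p ⁻¹' {a}) := by
    obtain ⟨x, hx⟩ := hps a
    have := hX.neBot_nhdsNE x
    exact (infinite_of_mem_nhds x ((hp.isOpen_fiber a).mem_nhds hx)).to_subtype
  have hemb (a : A) : Nonempty (T ↪ p ⁻¹' {a}) := by
    obtain ⟨n, ⟨i⟩⟩ := Finite.exists_equiv_fin T
    exact ⟨(i.toEmbedding.trans Fin.valEmbedding).trans (Infinite.natEmbedding _)⟩
  let pt (t : T) : X := (hemb (π t)).some t
  have hpt (t : T) : p (pt t) = π t := ((hemb (π t)).some t).2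
  have hpt_inj : Function.Injective pt := by
    intro t t' h
    have hπt : π t = π t' := by rw [← hpt, ← hpt, h]
    have hval : ∀ a, a = π t → ((hemb a).some t : X) = pt t := by rintro _ rfl; rfl
    exact (hemb (π t')).some.injective (Subtype.ext ((hval _ hπt.symm).trans h))
  obtain ⟨O, hO, hOdisj⟩ := Set.Finite.t2_separation (Set.finite_range pt)
  have hC (t : T) : ∃ C : Set X, IsClopen C ∧ pt t ∈ C ∧ C ⊆ O (pt t) ∩ p ⁻¹' {π t} :=
    hX.2.1.exists_subset_of_mem_open ⟨(hO _).1, hpt t⟩ ((hO _).2.inter (hp.isOpen_fiber _))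
  choose C hCclopen hCmem hCsub using hC
  have huniq {t t' : T} {x : X} (hx : x ∈ C t) (hx' : x ∈ C t') : t = t' := by
    by_contra hne
    exact (hOdisj ⟨t, rfl⟩ ⟨t', rfl⟩ (hpt_inj.ne hne)).le_bot
      ⟨(hCsub t hx).1, (hCsub t' hx').1⟩
  obtain ⟨σ, hσ⟩ := hπ.hasRightInverse
  let q (x : X) : T := if h : ∃ t, x ∈ C t then h.choose else σ (p x)
  have hq_mem {t : T} {x : X} (hx : x ∈ C t) : q x = t := by
    have h : ∃ t, x ∈ C t := ⟨t, hx⟩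
    simp only [q, dif_pos h]
    exact huniq h.choose_spec hx
  have hq_notMem {x : X} (hx : ¬∃ t, x ∈ C t) : q x = σ (p x) := dif_neg hx
  refine ⟨q, (IsLocallyConstant.iff_eventually_eq q).2 fun x => ?_,
    fun t => ⟨pt t, hq_mem (hCmem t)⟩, fun x => ?_⟩
  · by_cases hx : ∃ t, x ∈ C t
    · obtain ⟨t, ht⟩ := hx
      filter_upwards [(hCclopen t).isOpen.mem_nhds ht] with y hy
      rw [hq_mem hy, hq_mem ht]
    · have hclosed : IsClosed (⋃ t, C t) := isClosed_iUnion_of_finite fun t => (hCclopen t).1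
      filter_upwards [hclosed.isOpen_compl.mem_nhds (by simpa using hx),
        hp.eventually_eq x] with y hy hpy
      rw [hq_notMem hx, hq_notMem (by simpa using hy), hpy]
  · by_cases hx : ∃ t, x ∈ C t
    · obtain ⟨t, ht⟩ := hx
      rw [hq_mem ht]
      exact (hCsub t ht).2.symm
    · rw [hq_notMem hx, hσ]

/-- Two locally constant maps from an h-homogeneous compact Hausdorff space onto the same type
differ by a self-homeomorphism of the space. -/
theorem IsHHomogeneous.exists_homeomorph_comp_eq_s12 {X : Type*} [TopologicalSpace X]
    [CompactSpace X] [T2Space X] (hX : IsHHomogeneous X) {T : Type*} {q q' : X → T}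
    (hq : IsLocallyConstant q) (hqs : Function.Surjective q)
    (hq' : IsLocallyConstant q') (hqs' : Function.Surjective q') :
    ∃ h : X ≃ₜ X, ∀ x, q' (h x) = q x := by
  have hfib (t : T) : Nonempty ((q ⁻¹' {t} : Set X) ≃ₜ (q' ⁻¹' {t} : Set X)) :=
    hX.2.2 _ _ (hq.isClopen_fiber t) (hq'.isClopen_fiber t) (hqs t) (hqs' t)
  let e (t : T) : (q ⁻¹' {t} : Set X) ≃ₜ (q' ⁻¹' {t} : Set X) := (hfib t).some
  let h : X ≃ X := Equiv.ofFiberEquiv (f := q) (g := q') fun t => (e t).toEquiv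
  have heq (t : T) (x : X) (hx : q x = t) : h x = e t ⟨x, hx⟩ := by
    subst hx
    rfl
  have hcont : Continuous h := by
    refine continuous_iff_continuousAt.2 fun x => ?_
    have hon : ContinuousOn h (q ⁻¹' {q x}) := by
      rw [continuousOn_iff_continuous_domRestrict]
      have : (q ⁻¹' {q x}).domRestrict h = fun y => ((e (q x) y : _) : X) :=
        funext fun y => heq _ y.1 y.2
      rw [this]
      fun_prop
    exact hon.continuousAt ((hq.isOpen_fiber (q x)).mem_nhds rfl)
  exact ⟨hcont.homeoOfEquivCompactToT2, fun x => Equiv.ofFiberEquiv_map _ x⟩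

/-- Let `X` be an h-homogeneous compact Hausdorff space, `λ = {U a : a ∈ A}` a finite
partition of `X` into nonempty clopen sets, and `r, s ⊆ A × A` relations with full domain
and range. Then there are self-homeomorphisms `f, g` of `X` with `M(λ, f) = r`,
`M(λ, g) = s`, and `M(λ, f ∘ g) = rs`. -/
theorem exists_homeomorphs_M_eq_and_M_comp_eq
    {X : Type*} [TopologicalSpace X] [CompactSpace X] [T2Space X]
    (hX : IsHHomogeneous X)
    {A : Type*} [Finite A] (U : A → Set X)
    (hclopen : ∀ a, IsClopen (U a)) (hne : ∀ a, (U a).Nonempty)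
    (hdisj : Pairwise (Disjoint on U)) (hcover : ⋃ a, U a = Set.univ)
    (r s : Set (A × A))
    (hrdom : ∀ a, ∃ b, (a, b) ∈ r) (hrran : ∀ b, ∃ a, (a, b) ∈ r)
    (hsdom : ∀ a, ∃ b, (a, b) ∈ s) (hsran : ∀ b, ∃ a, (a, b) ∈ s) :
    ∃ f g : X ≃ₜ X,
      MRel U {p : X × X | p.2 = f p.1} = r ∧
      MRel U {p : X × X | p.2 = g p.1} = s ∧
      MRel U {p : X × X | p.2 = f (g p.1)} = relComp r s := by
  have hp (x : X) : ∃ a, x ∈ U a := by simpa using hcover.ge (mem_univ x)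
  choose p hp using hp
  have hpU {x : X} {a : A} : x ∈ U a ↔ p x = a := by
    refine ⟨fun hx => ?_, fun h => h ▸ hp x⟩
    by_contra hne
    exact (hdisj hne).le_bot ⟨hp x, hx⟩
  have hps : Function.Surjective p := fun a => (hne a).imp fun x hx => hpU.1 hx
  have hM (h : X → X) (a b : A) :
      (a, b) ∈ MRel U {z : X × X | z.2 = h z.1} ↔ ∃ x, p x = a ∧ p (h x) = b := by
    simp [MRel, Set.Nonempty, hpU]
  obtain hsub | _ := subsingleton_or_nontrivial X
  · have : Subsingleton A := hps.subsingleton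
    obtain ⟨x⟩ := hX.1
    have huniv {t : Set (A × A)} (ht : ∀ a, ∃ b, (a, b) ∈ t) (a b : A) : (a, b) ∈ t := by
      obtain ⟨c, hc⟩ := ht a
      rwa [Subsingleton.elim b c]
    have hMuniv (h : X → X) (a b : A) : (a, b) ∈ MRel U {z : X × X | z.2 = h z.1} :=
      (hM h a b).2 ⟨x, Subsingleton.elim _ _, Subsingleton.elim _ _⟩
    refine ⟨.refl X, .refl X, ?_, ?_, ?_⟩ <;> ext ⟨a, b⟩
    · exact iff_of_true (hMuniv _ a b) (huniv hrdom a b)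
    · exact iff_of_true (hMuniv _ a b) (huniv hsdom a b)
    · exact iff_of_true (hMuniv _ a b) ⟨a, huniv hsdom a a, huniv hrdom a b⟩
  have hplc : IsLocallyConstant p := IsLocallyConstant.iff_isOpen_fiber.2 fun a => by
    have : p ⁻¹' {a} = U a := Set.ext fun x => hpU.symm
    simpa [this] using (hclopen a).isOpen
  -- the two-step paths `a → c → b` with `(a, c) ∈ s` and `(c, b) ∈ r`
  let T := {t : A × A × A // (t.1, t.2.1) ∈ s ∧ (t.2.1, t.2.2) ∈ r}
  obtain ⟨q₁, hq₁, hqs₁, hqp₁⟩ := hX.exists_surjective_lift hplc hps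
    (π := fun t : T => t.1.1) fun a => by
      obtain ⟨c, hc⟩ := hsdom a
      obtain ⟨b, hb⟩ := hrdom c
      exact ⟨⟨(a, c, b), hc, hb⟩, rfl⟩
  obtain ⟨q₂, hq₂, hqs₂, hqp₂⟩ := hX.exists_surjective_lift hplc hps
    (π := fun t : T => t.1.2.1) fun c => by
      obtain ⟨a, ha⟩ := hsran c
      obtain ⟨b, hb⟩ := hrdom c
      exact ⟨⟨(a, c, b), ha, hb⟩, rfl⟩
  obtain ⟨q₃, hq₃, hqs₃, hqp₃⟩ := hX.exists_surjective_lift hplc hps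
    (π := fun t : T => t.1.2.2) fun b => by
      obtain ⟨c, hc⟩ := hrran b
      obtain ⟨a, ha⟩ := hsran c
      exact ⟨⟨(a, c, b), ha, hc⟩, rfl⟩
  obtain ⟨g, hg⟩ := hX.exists_homeomorph_comp_eq_s12 hq₁ hqs₁ hq₂ hqs₂
  obtain ⟨f, hf⟩ := hX.exists_homeomorph_comp_eq_s12 hq₂ hqs₂ hq₃ hqs₃
  have hpg (x : X) : p (g x) = (q₁ x).1.2.1 := by rw [← hqp₂, hg]
  have hpf (x : X) : p (f x) = (q₂ x).1.2.2 := by rw [← hqp₃, hf]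
  refine ⟨f, g, ?_, ?_, ?_⟩ <;> ext ⟨a, b⟩
  · rw [hM f]
    constructor
    · rintro ⟨x, rfl, rfl⟩
      rw [hpf, ← hqp₂]
      exact (q₂ x).2.2
    · intro hab
      obtain ⟨c, hc⟩ := hsran a
      obtain ⟨x, hx⟩ := hqs₂ ⟨(c, a, b), hc, hab⟩
      exact ⟨x, by rw [← hqp₂, hx], by rw [hpf, hx]⟩
  · rw [hM g]
    constructor
    · rintro ⟨x, rfl, rfl⟩
      rw [hpg, ← hqp₁]
      exact (q₁ x).2.1
    · intro hab
      obtain ⟨c, hc⟩ := hrdom b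
      obtain ⟨x, hx⟩ := hqs₁ ⟨(a, b, c), hab, hc⟩
      exact ⟨x, by rw [← hqp₁, hx], by rw [hpg, hx]⟩
  · rw [hM fun x => f (g x)]
    constructor
    · rintro ⟨x, rfl, rfl⟩
      refine ⟨(q₁ x).1.2.1, ?_, ?_⟩
      · rw [← hqp₁]
        exact (q₁ x).2.1
      · rw [hpf, hg]
        exact (q₁ x).2.2
    · rintro ⟨c, hac, hcb⟩
      obtain ⟨x, hx⟩ := hqs₁ ⟨(a, c, b), hac, hcb⟩
      exact ⟨x, by rw [← hqp₁, hx], by rw [hpf, hg, hx]⟩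
end
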